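/- Let n, m : ℕ, A ∈ ℝ^{n×n}, B ∈ ℝ^{n×m}, let Q ∈ ℝ^{n×n} be symmetric positive semidefinite, let R ∈ ℝ^{m×m} be symmetric positive definite, and let P ∈ ℝ^{n×n}. Set S := P + Pᵀ, Ξ := B R⁻¹ Bᵀ, and A_cl := A − (1/2) Ξ S. Assume: (i) A_cl is Hurwitz; (ii) η ∈ ℝ and P̄ ∈ ℝ^{n×n} is symmetric positive definite such that the symmetric block matrix [[−(Aᵀ P̄ + P̄ A + Q) + η·I, (S − 2P̄) B], [Bᵀ (S − 2P̄), 4 R]] is positive definite; (iii) Y ∈ ℝ^{n×n} is symmetric and satisfies A_clᵀ Y + Y A_cl + Q + (1/4) S Ξ S = 0; (iv) P̃ ∈ ℝ^{n×n} is symmetric and satisfies A_clᵀ P̃ + P̃ A_cl + I = 0. Then P̄ + η·P̃ − Y is positive definite; in particular, x₀ᵀ Y x₀ < x₀ᵀ (P̄ + η·P̃) x₀ for every x₀ ≠ 0. -/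

import Mathlib

open Matrix

open Filter Topology in
/-- In a complex Banach algebra, the powers of an element whose spectrum lies in the open unit disc
tend to zero. -/
lemma tendsto_pow_zero_of_spectrum_norm_lt_one {E : Type*} [NormedRing E] [NormedAlgebra ℂ E]
    [CompleteSpace E] [Nontrivial E] (a : E) (h : ∀ z ∈ spectrum ℂ a, ‖z‖ < 1) :
    Tendsto (fun k : ℕ => a ^ k) atTop (𝓝 0) := by
  have hr : spectralRadius ℂ a < (1 : NNReal) :=
    spectrum.spectralRadius_lt_of_forall_lt a fun z hz => by exact_mod_cast h z hz
  obtain ⟨r, hr1, hr2⟩ := ENNReal.lt_iff_exists_nnreal_btwn.1 hr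
  have hr2' : (r : ℝ) < 1 := by exact_mod_cast hr2
  have hev := (spectrum.pow_nnnorm_pow_one_div_tendsto_nhds_spectralRadius a).eventually_lt_const hr1
  refine squeeze_zero_norm' ?_ (tendsto_pow_atTop_nhds_zero_of_lt_one r.coe_nonneg hr2')
  filter_upwards [hev, eventually_gt_atTop 0] with k hk hk0
  have hk0' : (0 : ℝ) < k := by exact_mod_cast hk0
  have h1 := ENNReal.rpow_le_rpow hk.le hk0'.le
  rw [← ENNReal.rpow_mul, one_div, inv_mul_cancel₀ hk0'.ne', ENNReal.rpow_one,
    ENNReal.rpow_natCast] at h1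
  exact_mod_cast h1

open Filter Topology Matrix.Norms.Operator in
/-- The powers of a real matrix whose complex spectrum lies in the open unit disc tend to zero. -/
lemma Matrix.tendsto_pow_zero_of_spectrum_norm_lt_one {ι : Type*} [Fintype ι] [DecidableEq ι]
    (C : Matrix ι ι ℝ) (h : ∀ z ∈ spectrum ℂ (C.map ((↑) : ℝ → ℂ)), ‖z‖ < 1) :
    Tendsto (fun k : ℕ => C ^ k) atTop (𝓝 0) := by
  cases isEmpty_or_nonempty ι
  · exact tendsto_const_nhds.congr fun k => Subsingleton.elim _ _
  have key := _root_.tendsto_pow_zero_of_spectrum_norm_lt_one (C.map ((↑) : ℝ → ℂ)) h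
  have hre : Continuous fun M : Matrix ι ι ℂ => M.map Complex.re :=
    Continuous.matrix_map continuous_id Complex.continuous_re
  have := (hre.tendsto 0).comp key
  have h0 : (0 : Matrix ι ι ℂ).map Complex.re = 0 := by ext; simp
  rw [h0] at this
  refine this.congr fun k => ?_
  have hk : (C.map ((↑) : ℝ → ℂ)) ^ k = (C ^ k).map ((↑) : ℝ → ℂ) :=
    (map_pow (Complex.ofRealHom.mapMatrix (m := ι)) C k).symm
  ext i j
  simp [hk]

/-- If `c` is the Cayley transform of `a` and the spectrum of `a` lies in the open left half-plane,
then the spectrum of `c` lies in the open unit disc. -/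
lemma norm_lt_one_of_mem_spectrum_cayley {E : Type*} [Ring E] [Algebra ℂ E] {a c : E}
    (ha : ∀ z ∈ spectrum ℂ a, z.re < 0) (hc : c * (1 - a) = 1 + a) :
    ∀ z ∈ spectrum ℂ c, ‖z‖ < 1 := by
  have hunit : ∀ z : ℂ, 0 ≤ z.re → IsUnit (algebraMap ℂ E z - a) := fun z hz =>
    spectrum.notMem_iff.1 fun hmem => (ha z hmem).not_ge hz
  have h1 : IsUnit (1 - a) := by simpa using hunit 1 (by simp)
  intro z hz
  by_contra! hlt
  refine (spectrum.mem_iff.1 hz) ?_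
  suffices IsUnit ((algebraMap ℂ E z - c) * (1 - a)) by
    obtain ⟨u, hu⟩ := h1
    rwa [← hu, Units.isUnit_mul_units] at this
  rw [sub_mul, hc]
  by_cases hz1 : z + 1 = 0
  · have h2 : algebraMap ℂ E z * (1 - a) - (1 + a) = algebraMap ℂ E (-2) := by
      rw [eq_neg_of_add_eq_zero_left hz1]
      simp only [map_neg, map_one, map_ofNat, neg_mul, one_mul]
      rw [← one_add_one_eq_two]
      abel
    rw [h2]
    exact (IsUnit.mk0 (-2 : ℂ) (by norm_num)).map _
  · have h2 : algebraMap ℂ E z * (1 - a) - (1 + a) =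
        algebraMap ℂ E (z + 1) * (algebraMap ℂ E ((z - 1) / (z + 1)) - a) := by
      rw [mul_sub (algebraMap ℂ E (z + 1)), ← map_mul, mul_div_cancel₀ _ hz1]
      simp only [map_add, map_sub, map_one]
      noncomm_ring
    rw [h2]
    refine ((IsUnit.mk0 _ hz1).map _).mul (hunit _ ?_)
    have h3 : 1 ≤ z.re * z.re + z.im * z.im := by
      rw [← Complex.normSq_apply, Complex.normSq_eq_norm_sq]
      nlinarith
    rw [Complex.div_re, ← add_div]
    refine div_nonneg ?_ (Complex.normSq_nonneg _)
    simp only [Complex.sub_re, Complex.add_re, Complex.sub_im, Complex.add_im, Complex.one_re,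
      Complex.one_im]
    nlinarith

open Filter Topology in
/-- **Stein's criterion**: if the powers of `C` tend to zero and `X - Cᵀ X C` is positive definite,
then so is `X`. -/
lemma Matrix.posDef_of_stein {ι : Type*} [Fintype ι] [DecidableEq ι] {C X : Matrix ι ι ℝ}
    (hX : Xᵀ = X) (hC : Tendsto (fun k : ℕ => C ^ k) atTop (𝓝 0))
    (hW : (X - Cᵀ * X * C).PosDef) : X.PosDef := by
  refine .of_dotProduct_mulVec_pos (by simpa [IsHermitian] using hX) fun x hx => ?_
  simp only [star_trivial]
  have hstep : ∀ y : ι → ℝ, y ⬝ᵥ ((X - Cᵀ * X * C) *ᵥ y) =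
      y ⬝ᵥ (X *ᵥ y) - (C *ᵥ y) ⬝ᵥ (X *ᵥ (C *ᵥ y)) := fun y => by
    rw [sub_mulVec, dotProduct_sub, Matrix.mul_assoc, ← mulVec_mulVec, ← mulVec_mulVec,
      dotProduct_mulVec y Cᵀ, vecMul_transpose]
  set f : ℕ → ℝ := fun k => ((C ^ k) *ᵥ x) ⬝ᵥ (X *ᵥ ((C ^ k) *ᵥ x)) with hf
  have hsucc : ∀ k, f k - f (k + 1) =
      ((C ^ k) *ᵥ x) ⬝ᵥ ((X - Cᵀ * X * C) *ᵥ ((C ^ k) *ᵥ x)) := fun k => by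
    rw [hstep]
    simp only [hf, pow_succ' C k, mulVec_mulVec]
  have hanti : Antitone f := antitone_nat_of_succ_le fun k => by
    have := hW.posSemidef.dotProduct_mulVec_nonneg ((C ^ k) *ᵥ x)
    rw [star_trivial, ← hsucc] at this
    linarith
  have hcont : Continuous fun M : Matrix ι ι ℝ => (M *ᵥ x) ⬝ᵥ (X *ᵥ (M *ᵥ x)) := by fun_prop
  have hlim : Tendsto f atTop (𝓝 0) := by
    have h := (hcont.tendsto 0).comp hC
    simp only [zero_mulVec, zero_dotProduct] at h
    exact h
  have h1 : 0 ≤ f 1 := hanti.le_of_tendsto hlim 1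
  have h2 := hW.dotProduct_mulVec_pos hx
  have h3 := hsucc 0
  have h0 : f 0 = x ⬝ᵥ (X *ᵥ x) := by simp [hf]
  simp only [star_trivial] at h2
  simp only [pow_zero, one_mulVec, zero_add, h0] at h3
  linarith

/-- **Lyapunov's criterion**: if `A` is Hurwitz and `-(Aᵀ X + X A)` is positive definite, then so
is `X`. -/
lemma Matrix.posDef_of_lyapunov {ι : Type*} [Fintype ι] [DecidableEq ι] {A X : Matrix ι ι ℝ}
    (hA : ∀ μ ∈ spectrum ℂ (A.map ((↑) : ℝ → ℂ)), μ.re < 0) (hX : Xᵀ = X)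
    (hW : (-(Aᵀ * X + X * A)).PosDef) : X.PosDef := by
  let φ : Matrix ι ι ℝ →+* Matrix ι ι ℂ := Complex.ofRealHom.mapMatrix
  have hmap : ∀ M, φ M = M.map ((↑) : ℝ → ℂ) := fun M => rfl
  have hdet : IsUnit (1 - A).det := by
    have h1 : IsUnit (φ (1 - A)) := by
      have := spectrum.notMem_iff.1 fun hmem => (hA 1 hmem).not_ge (by simp)
      simpa [hmap A] using this
    rw [isUnit_iff_isUnit_det, ← RingHom.map_det, isUnit_iff_ne_zero, map_ne_zero] at h1
    exact h1.isUnit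
  set J := (1 - A)⁻¹ with hJ
  have hJ1 : J * (1 - A) = 1 := nonsing_inv_mul _ hdet
  have hJ2 : (1 - A) * J = 1 := mul_nonsing_inv _ hdet
  have hCJ : (1 + A) * J * (1 - A) = 1 + A := by rw [Matrix.mul_assoc, hJ1, Matrix.mul_one]
  refine posDef_of_stein (C := (1 + A) * J) hX (tendsto_pow_zero_of_spectrum_norm_lt_one _ ?_) ?_
  · rw [← hmap] at hA ⊢
    refine norm_lt_one_of_mem_spectrum_cayley hA ?_
    simpa using congrArg φ hCJ
  · have hJinj : Function.Injective J.mulVec := fun x y hxy => by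
      have h := congrArg ((1 - A) *ᵥ ·) hxy
      simp only [mulVec_mulVec, hJ2, one_mulVec] at h
      exact h
    have h2 := (hW.smul (two_pos : (0 : ℝ) < 2)).conjTranspose_mul_mul_same hJinj
    convert h2 using 1
    have hXJ : X = Jᵀ * ((1 - A)ᵀ * X * (1 - A)) * J := by
      have h3 : Jᵀ * (1 - A)ᵀ = 1 := by rw [← transpose_mul, hJ2, transpose_one]
      calc X = Jᵀ * (1 - A)ᵀ * X * ((1 - A) * J) := by rw [h3, hJ2, Matrix.one_mul, Matrix.mul_one]
        _ = _ := by simp only [Matrix.mul_assoc]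
    nth_rewrite 1 [hXJ]
    rw [conjTranspose_eq_transpose_of_trivial]
    simp only [transpose_mul, transpose_sub, transpose_add, transpose_one, two_smul]
    noncomm_ring

/-- The paper's Proposition 6: suboptimality bound for the ε-suboptimal LQR design
for possibly unstable systems. -/
theorem suboptimal_lqr_bound_unstable
    (n m : ℕ)
    (A : Matrix (Fin n) (Fin n) ℝ) (B : Matrix (Fin n) (Fin m) ℝ)
    (Q : Matrix (Fin n) (Fin n) ℝ) (R : Matrix (Fin m) (Fin m) ℝ)
    (hQ : Q.PosSemidef) (hR : R.PosDef)
    (P : Matrix (Fin n) (Fin n) ℝ)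
    (S : Matrix (Fin n) (Fin n) ℝ) (hS : S = P + Pᵀ)
    (Ξ : Matrix (Fin n) (Fin n) ℝ) (hΞ : Ξ = B * R⁻¹ * Bᵀ)
    (Acl : Matrix (Fin n) (Fin n) ℝ) (hAcl : Acl = A - (1/2 : ℝ) • (Ξ * S))
    (hHurwitz : ∀ μ ∈ spectrum ℂ (Acl.map ((↑) : ℝ → ℂ)), μ.re < 0)
    (η : ℝ)
    (Pbar : Matrix (Fin n) (Fin n) ℝ) (hPbar : Pbar.PosDef)
    (hLMI : (Matrix.fromBlocks
      (-(Aᵀ * Pbar + Pbar * A + Q) + η • (1 : Matrix (Fin n) (Fin n) ℝ))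
      ((S - (2:ℝ) • Pbar) * B)
      (Bᵀ * (S - (2:ℝ) • Pbar)) ((4:ℝ) • R)).PosDef)
    (Y : Matrix (Fin n) (Fin n) ℝ) (hYsymm : Yᵀ = Y)
    (hYlyap : Aclᵀ * Y + Y * Acl + Q + (1/4 : ℝ) • (S * Ξ * S) = 0)
    (Ptil : Matrix (Fin n) (Fin n) ℝ) (hPtilsymm : Ptilᵀ = Ptil)
    (hPtil : Aclᵀ * Ptil + Ptil * Acl + 1 = 0) :
    (Pbar + η • Ptil - Y).PosDef ∧
    ∀ x₀ : Fin n → ℝ, x₀ ≠ 0 →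
      x₀ ⬝ᵥ (Y *ᵥ x₀) < x₀ ⬝ᵥ ((Pbar + η • Ptil) *ᵥ x₀) := by
  have hSt : Sᵀ = S := by rw [hS, transpose_add, transpose_transpose, add_comm]
  have hRt : Rᵀ = R := by simpa [IsHermitian] using hR.1
  have hPt : Pbarᵀ = Pbar := by simpa [IsHermitian] using hPbar.1
  have hRdet : IsUnit R.det := (isUnit_iff_isUnit_det R).1 hR.isUnit
  have hGt : R⁻¹ᵀ = R⁻¹ := by rw [transpose_nonsing_inv, hRt]
  have hΞt : Ξᵀ = Ξ := by
    rw [hΞ]; simp only [transpose_mul, transpose_transpose, hGt, Matrix.mul_assoc]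
  have hmain : (Pbar + η • Ptil - Y).PosDef := by
    refine posDef_of_lyapunov hHurwitz (by simp [hPt, hPtilsymm, hYsymm]) ?_
    set L : Matrix (Fin m) (Fin n) ℝ := (-(1/4) : ℝ) • (R⁻¹ * Bᵀ * S) with hL
    have hinj : Function.Injective (fromRows (1 : Matrix (Fin n) (Fin n) ℝ) L).mulVec := by
      intro x y hxy
      simp only [fromRows_mulVec, one_mulVec] at hxy
      exact funext fun i => congrFun hxy (Sum.inl i)
    have hN := hLMI.conjTranspose_mul_mul_same hinj
    convert hN using 1
    have hLt : Lᵀ = (-(1/4) : ℝ) • (S * B * R⁻¹) := by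
      rw [hL]; simp only [transpose_smul, transpose_mul, transpose_transpose, hGt, hSt, Matrix.mul_assoc]
    have hBL : B * L = (-(1/4) : ℝ) • (Ξ * S) := by
      rw [hL, hΞ]; simp only [Matrix.mul_smul, Matrix.mul_assoc]
    have hLB : Lᵀ * Bᵀ = (-(1/4) : ℝ) • (S * Ξ) := by
      rw [hLt, hΞ]; simp only [Matrix.smul_mul, Matrix.mul_assoc]
    have hRL : R * L = (-(1/4) : ℝ) • (Bᵀ * S) := by
      rw [hL, Matrix.mul_smul, Matrix.mul_assoc, mul_nonsing_inv_cancel_left _ _ hRdet]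
    have hLRL : Lᵀ * (R * L) = (1/16 : ℝ) • (S * Ξ * S) := by
      rw [hRL, Matrix.mul_smul, ← Matrix.mul_assoc, hLB, Matrix.smul_mul, smul_smul]
      norm_num
    have hquad : (fromRows (1 : Matrix (Fin n) (Fin n) ℝ) L)ᴴ * fromBlocks
        (-(Aᵀ * Pbar + Pbar * A + Q) + η • (1 : Matrix (Fin n) (Fin n) ℝ))
        ((S - (2:ℝ) • Pbar) * B) (Bᵀ * (S - (2:ℝ) • Pbar)) ((4:ℝ) • R) *
        fromRows (1 : Matrix (Fin n) (Fin n) ℝ) L =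
        -(Aᵀ * Pbar + Pbar * A + Q) + η • (1 : Matrix (Fin n) (Fin n) ℝ) +
          (S - (2:ℝ) • Pbar) * (B * L) + Lᵀ * Bᵀ * (S - (2:ℝ) • Pbar) +
          (4:ℝ) • (Lᵀ * (R * L)) := by
      rw [conjTranspose_eq_transpose_of_trivial, transpose_fromRows, Matrix.mul_assoc,
        fromBlocks_mul_fromRows, fromCols_mul_fromRows]
      simp only [transpose_one, Matrix.one_mul, Matrix.mul_one, Matrix.mul_add, Matrix.mul_assoc,
        Matrix.smul_mul, Matrix.mul_smul]
      abel
    rw [hquad, hBL, hLB, hLRL]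
    have hY' : Aclᵀ * Y + Y * Acl = -(Q + (1/4 : ℝ) • (S * Ξ * S)) := by
      rw [eq_neg_iff_add_eq_zero, ← add_assoc]; exact hYlyap
    have hP' : Aclᵀ * Ptil + Ptil * Acl = -1 := eq_neg_of_add_eq_zero_left hPtil
    have hsplit : -(Aclᵀ * (Pbar + η • Ptil - Y) + (Pbar + η • Ptil - Y) * Acl) =
        -(Aclᵀ * Pbar + Pbar * Acl) - η • (Aclᵀ * Ptil + Ptil * Acl)
          + (Aclᵀ * Y + Y * Acl) := by
      simp only [Matrix.mul_add, Matrix.mul_sub, Matrix.add_mul, Matrix.sub_mul, Matrix.smul_mul,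
        Matrix.mul_smul, smul_add]
      abel
    rw [hsplit, hY', hP', hAcl]
    simp only [transpose_sub, transpose_smul, transpose_mul, hSt, hΞt, Matrix.mul_sub,
      Matrix.sub_mul, Matrix.smul_mul, Matrix.mul_smul, Matrix.mul_assoc]
    module
  refine ⟨hmain, fun x hx => ?_⟩
  have h := hmain.dotProduct_mulVec_pos hx
  rw [star_trivial, sub_mulVec, dotProduct_sub] at h
  linarith
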